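/- There exist ε₀ > 0 and C > 0 such that if f is a (1+ε)-biLipschitz self map of ℍ with ε < ε₀ and f(O) = O, then, with g(x,y,t) = (x,−y,−t), either d(f(0,0,t), (0,0,t)) ≤ C ε^{1/32} d(O,(0,0,t)) for all t ∈ ℝ, or d(g(f(0,0,t)), (0,0,t)) ≤ C ε^{1/32} d(O,(0,0,t)) for all t ∈ ℝ. -/

import Mathlib

noncomputable section

open MeasureTheory

/-- Points of the Heisenberg group `ℍ`, identified with `ℝ³ ≅ ℂ × ℝ`:
`(x, y, t)` corresponds to `(z ; t)` with `z = x + iy`. -/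
abbrev H : Type := ℝ × ℝ × ℝ

/-- The Heisenberg group law
`(x,y,t)·(x',y',t') = (x+x', y+y', t+t'+2(x'y − xy'))`. -/
def Hmul (p q : H) : H :=
  (p.1 + q.1, p.2.1 + q.2.1, p.2.2 + q.2.2 + 2 * (q.1 * p.2.1 - p.1 * q.2.1))

/-- The Heisenberg group inverse. -/
def Hinv (p : H) : H := (-p.1, -p.2.1, -p.2.2)

/-- The identity `O = (0,0,0)`. -/
def HO : H := (0, 0, 0)

/-- The control (Carnot–Carathéodory) distance: the infimum of the lengths
`∫₀¹ √(a(s)² + b(s)²) ds` of horizontal Lipschitz curves `γ` joining `P` to `Q`,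
i.e. curves satisfying a.e. `γ' = a·X(γ) + b·Y(γ)` where `X = ∂ₓ + 2y∂_t` and
`Y = ∂_y − 2x∂_t`. -/
def dH (P Q : H) : ℝ :=
  sInf { L : ℝ | ∃ (γ : ℝ → H) (a b : ℝ → ℝ) (K : NNReal),
    LipschitzWith K γ ∧ γ 0 = P ∧ γ 1 = Q ∧
    (∀ᵐ s ∂volume, s ∈ Set.Icc (0:ℝ) 1 →
      HasDerivAt γ (a s, b s, 2 * (γ s).2.1 * a s - 2 * (γ s).1 * b s) s) ∧
    IntervalIntegrable (fun s => Real.sqrt (a s ^ 2 + b s ^ 2)) volume 0 1 ∧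
    L = ∫ s in (0:ℝ)..1, Real.sqrt (a s ^ 2 + b s ^ 2) }

/-- `γ : ℝ → ℍ` is a `(1+ε)`-quasigeodesic. -/
def IsQuasiGeodesic (ε : ℝ) (γ : ℝ → H) : Prop :=
  ∀ s s' : ℝ, (1 + ε)⁻¹ * |s - s'| ≤ dH (γ s) (γ s') ∧
    dH (γ s) (γ s') ≤ (1 + ε) * |s - s'|

/-- `f : ℍ → ℍ` is `(1+ε)`-biLipschitz for the control distance. -/
def IsBiLip (ε : ℝ) (f : H → H) : Prop :=
  ∀ P Q : H, (1 + ε)⁻¹ * dH P Q ≤ dH (f P) (f Q) ∧ dH (f P) (f Q) ≤ (1 + ε) * dH P Q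

/-- `(a,b)` is the horizontal speed of `γ`: a.e. `γ'(s) = a(s)X(γ(s)) + b(s)Y(γ(s))`. -/
def HasHorizSpeed (γ : ℝ → H) (a b : ℝ → ℝ) : Prop :=
  ∀ᵐ s ∂volume, HasDerivAt γ (a s, b s, 2 * (γ s).2.1 * a s - 2 * (γ s).1 * b s) s

def Reach (P Q : H) (L : ℝ) : Prop := ∃ (γ : ℝ → H) (a b : ℝ → ℝ) (K : NNReal),
    LipschitzWith K γ ∧ γ 0 = P ∧ γ 1 = Q ∧
    (∀ᵐ s ∂volume, s ∈ Set.Icc (0:ℝ) 1 →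
      HasDerivAt γ (a s, b s, 2 * (γ s).2.1 * a s - 2 * (γ s).1 * b s) s) ∧
    IntervalIntegrable (fun s => Real.sqrt (a s ^ 2 + b s ^ 2)) volume 0 1 ∧
    L = ∫ s in (0:ℝ)..1, Real.sqrt (a s ^ 2 + b s ^ 2)

lemma dH_eq (P Q : H) : dH P Q = sInf {L : ℝ | Reach P Q L} := rfl

lemma reach_nonneg {P Q : H} {L : ℝ} (h : Reach P Q L) : 0 ≤ L := by
  obtain ⟨γ, a, b, K, -, -, -, -, -, rfl⟩ := h
  exact intervalIntegral.integral_nonneg (by norm_num) (fun _ _ => Real.sqrt_nonneg _)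

lemma ftc_bound (φ φ' F : ℝ → ℝ) (K : NNReal) (hφ : LipschitzWith K φ)
    (hd : ∀ᵐ s ∂volume, s ∈ Set.Icc (0:ℝ) 1 → HasDerivAt φ (φ' s) s)
    (hF : IntervalIntegrable F volume 0 1)
    (hb : ∀ᵐ s ∂volume, s ∈ Set.Icc (0:ℝ) 1 → |φ' s| ≤ F s) (u : ℝ) (hu : u ∈ Set.Icc (0:ℝ) 1) :
    |φ u - φ 0| ≤ ∫ s in (0:ℝ)..u, F s := by
  have hac : AbsolutelyContinuousOnInterval φ 0 u :=
    (hφ.lipschitzOnWith (s := Set.uIcc 0 u)).absolutelyContinuousOnInterval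
  rw [← hac.integral_deriv_eq_sub, ← Real.norm_eq_abs]
  apply intervalIntegral.norm_integral_le_of_norm_le hu.1
  · filter_upwards [hd, hb] with s h1 h2 hs
    have hs' : s ∈ Set.Icc (0:ℝ) 1 := ⟨hs.1.le, hs.2.trans hu.2⟩
    rw [(h1 hs').deriv]
    exact h2 hs'
  · apply hF.mono_set
    rw [Set.uIcc_of_le hu.1, Set.uIcc_of_le zero_le_one]
    exact Set.Icc_subset_Icc le_rfl hu.2

lemma cs2 (p q a b : ℝ) : |p * a + q * b| ≤ √(p^2+q^2) * √(a^2+b^2) := by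
  rw [← Real.sqrt_mul (by positivity)]
  apply Real.abs_le_sqrt
  nlinarith [sq_nonneg (p*b - q*a)]

lemma lip_coords {K : NNReal} {γ : ℝ → H} (hγ : LipschitzWith K γ) :
    LipschitzWith K (fun s => (γ s).1) ∧ LipschitzWith K (fun s => (γ s).2.1) ∧
    LipschitzWith K (fun s => (γ s).2.2) := by
  have hx := LipschitzWith.prod_fst.comp hγ
  have hyt := LipschitzWith.prod_snd.comp hγ
  have hy := LipschitzWith.prod_fst.comp hyt
  have ht := LipschitzWith.prod_snd.comp hyt
  simp only [one_mul] at hx hy ht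
  exact ⟨hx, hy, ht⟩

lemma lip_mul {K : NNReal} (c : ℝ) {φ : ℝ → ℝ} (hφ : LipschitzWith K φ) :
    LipschitzWith (‖c‖₊ * K) (fun s => c * φ s) :=
  (lipschitzWith_smul c).comp hφ

lemma reach_lower {P : H} {L : ℝ} (h : Reach HO P L) :
    √(P.1^2 + P.2.1^2) ≤ L ∧ |P.2.2| ≤ 2 * L^2 := by
  have hL0 := reach_nonneg h
  obtain ⟨γ, a, b, K, hγ, h0, h1, hd, hi, hL⟩ := h
  obtain ⟨hx, hy, ht⟩ := lip_coords hγ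
  have hmono : ∀ u ∈ Set.Icc (0:ℝ) 1, ∫ s in (0:ℝ)..u, √(a s ^ 2 + b s ^ 2) ≤ L := by
    intro u hu
    rw [hL]
    apply intervalIntegral.integral_mono_interval le_rfl hu.1 hu.2 _ hi
    exact Filter.Eventually.of_forall (fun _ => Real.sqrt_nonneg _)
  have hz : ∀ u ∈ Set.Icc (0:ℝ) 1, √((γ u).1^2 + (γ u).2.1^2) ≤ L := by
    intro u hu
    set R := √((γ u).1^2 + (γ u).2.1^2) with hR
    rcases (Real.sqrt_nonneg ((γ u).1^2 + (γ u).2.1^2)).eq_or_lt with h | hpos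
    · rw [hR, ← h]; exact hL0
    have hR2 : R^2 = (γ u).1^2 + (γ u).2.1^2 := Real.sq_sqrt (by positivity)
    rw [← hR] at hpos
    set p := (γ u).1 / R
    set q := (γ u).2.1 / R
    have hpq : p^2+q^2 = 1 := by
      simp only [p, q]; field_simp; rw [hR2]
    have := ftc_bound (fun s => p * (γ s).1 + q * (γ s).2.1) (fun s => p * a s + q * b s)
      (fun s => √(a s ^ 2 + b s ^ 2)) _
      (((lip_mul p hx)).add (lip_mul q hy)) ?_ hi ?_ u hu
    · refine le_trans ?_ (this.trans (hmono u hu))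
      simp only [h0, HO]
      refine le_trans (le_of_eq ?_) (le_abs_self _)
      simp only [p, q]; field_simp; rw [hR2]; ring
    · filter_upwards [hd] with s hs hs'
      have := hs hs'
      have e1 := hasFDerivAt_fst.comp_hasDerivAt s this
      have e2 := hasFDerivAt_fst.comp_hasDerivAt s (hasFDerivAt_snd.comp_hasDerivAt s this)
      exact (e1.const_mul p).add (e2.const_mul q)
    · filter_upwards with s hs
      have := cs2 p q (a s) (b s)
      rwa [hpq, Real.sqrt_one, one_mul] at this
  constructor
  · have := hz 1 (by simp)
    rwa [h1] at this
  · have := ftc_bound (fun s => (γ s).2.2) (fun s => 2 * (γ s).2.1 * a s - 2 * (γ s).1 * b s)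
      (fun s => (2 * L) * √(a s ^ 2 + b s ^ 2)) _ ht ?_ (hi.const_mul _) ?_ 1 (by simp)
    · rw [intervalIntegral.integral_const_mul, ← hL] at this
      simp only [h0, h1, HO, sub_zero] at this
      linarith
    · filter_upwards [hd] with s hs hs'
      have := hs hs'
      exact hasFDerivAt_snd.comp_hasDerivAt s (hasFDerivAt_snd.comp_hasDerivAt s this)
    · filter_upwards with s hs
      have h3 := cs2 (2 * (γ s).2.1) (-(2 * (γ s).1)) (a s) (b s)
      have h4 := hz s hs
      have h5 : √((2 * (γ s).2.1)^2 + (-(2 * (γ s).1))^2) = 2 * √((γ s).1^2 + (γ s).2.1^2) := by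
        rw [show (2 * (γ s).2.1)^2 + (-(2 * (γ s).1))^2 = 2^2 * ((γ s).1^2 + (γ s).2.1^2) by ring,
          Real.sqrt_mul (by norm_num), Real.sqrt_sq (by norm_num)]
      rw [h5] at h3
      rw [show 2 * (γ s).2.1 * a s + -(2 * (γ s).1) * b s
        = 2 * (γ s).2.1 * a s - 2 * (γ s).1 * b s by ring] at h3
      refine h3.trans ?_
      gcongr

lemma reach_left (A : H) {P Q : H} {L : ℝ} (h : Reach P Q L) :
    Reach (Hmul A P) (Hmul A Q) L := by
  obtain ⟨γ, a, b, K, hγ, h0, h1, hd, hi, hL⟩ := h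
  have hlip : ∃ K', LipschitzWith K' (fun s => Hmul A (γ s)) := by
    obtain ⟨hx, hy, ht⟩ := lip_coords hγ
    have e1 := (LipschitzWith.const A.1).add hx
    have e2 := (LipschitzWith.const A.2.1).add hy
    have e3 := ((LipschitzWith.const A.2.2).add ht).add
      ((lip_mul (2*A.2.1) hx).add (lip_mul (-(2*A.1)) hy))
    have e4 := e1.prodMk (e2.prodMk e3)
    have e5 : (fun s => Hmul A (γ s)) = fun x => (A.1 + (γ x).1, A.2.1 + (γ x).2.1,
        A.2.2 + (γ x).2.2 + (2 * A.2.1 * (γ x).1 + -(2 * A.1) * (γ x).2.1)) := by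
      funext s
      simp only [Hmul, Prod.mk.injEq, true_and]
      ring
    rw [e5]
    exact ⟨_, e4⟩
  obtain ⟨K', hK'⟩ := hlip
  refine ⟨fun s => Hmul A (γ s), a, b, K', hK', by simp only [h0], by simp only [h1], ?_, hi, hL⟩
  filter_upwards [hd] with s hs hs'
  have := hs hs'
  have e1 := hasFDerivAt_fst.comp_hasDerivAt s this
  have e2 := hasFDerivAt_fst.comp_hasDerivAt s (hasFDerivAt_snd.comp_hasDerivAt s this)
  have e3 := hasFDerivAt_snd.comp_hasDerivAt s (hasFDerivAt_snd.comp_hasDerivAt s this)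
  have := (e1.const_add A.1).prodMk ((e2.const_add A.2.1).prodMk
    ((e3.const_add A.2.2).add (((e1.mul_const A.2.1).sub (e2.const_mul A.1)).const_mul 2)))
  convert! this using 1
  simp [Hmul]
  ring

def Hdil (r : ℝ) (p : H) : H := (r * p.1, r * p.2.1, r^2 * p.2.2)

lemma reach_dil (r : ℝ) (hr : 0 ≤ r) {P Q : H} {L : ℝ} (h : Reach P Q L) :
    Reach (Hdil r P) (Hdil r Q) (r * L) := by
  obtain ⟨γ, a, b, K, hγ, h0, h1, hd, hi, hL⟩ := h
  obtain ⟨hx, hy, ht⟩ := lip_coords hγ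
  have e4 := (lip_mul r hx).prodMk ((lip_mul r hy).prodMk (lip_mul (r^2) ht))
  have hs : ∀ s, √((r * a s)^2 + (r * b s)^2) = r * √(a s^2 + b s^2) := by
    intro s
    rw [show (r * a s)^2 + (r * b s)^2 = r^2 * (a s^2 + b s^2) by ring,
      Real.sqrt_mul (by positivity), Real.sqrt_sq hr]
  refine ⟨fun s => Hdil r (γ s), fun s => r * a s, fun s => r * b s, _, e4,
    by simp only [h0], by simp only [h1], ?_, ?_, ?_⟩
  · filter_upwards [hd] with s hs hs'
    have := hs hs'
    have e1 := hasFDerivAt_fst.comp_hasDerivAt s this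
    have e2 := hasFDerivAt_fst.comp_hasDerivAt s (hasFDerivAt_snd.comp_hasDerivAt s this)
    have e3 := hasFDerivAt_snd.comp_hasDerivAt s (hasFDerivAt_snd.comp_hasDerivAt s this)
    have := (e1.const_mul r).prodMk ((e2.const_mul r).prodMk (e3.const_mul (r^2)))
    convert! this using 1
    simp [Hdil]
    ring
  · simp only [hs]; exact hi.const_mul r
  · simp only [hs]; rw [intervalIntegral.integral_const_mul, hL]

lemma ae_comp_affine {p : ℝ → Prop} (c d : ℝ) (hc : c ≠ 0) (h : ∀ᵐ s ∂volume, p s) :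
    ∀ᵐ s ∂volume, p (c * s + d) := by
  have q1 : Measure.QuasiMeasurePreserving (fun s : ℝ => c * s) volume volume := by
    refine ⟨by fun_prop, ?_⟩
    rw [Real.map_volume_mul_left hc]
    exact Measure.smul_absolutelyContinuous
  have q2 : Measure.QuasiMeasurePreserving (fun s : ℝ => s + d) volume volume :=
    (measurePreserving_add_right volume d).quasiMeasurePreserving
  exact (q2.comp q1).ae h

lemma reach_symm {P Q : H} {L : ℝ} (h : Reach P Q L) : Reach Q P L := by
  obtain ⟨γ, a, b, K, hγ, h0, h1, hd, hi, hL⟩ := h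
  have l1 : LipschitzWith 1 (fun s : ℝ => 1 - s) := by
    apply LipschitzWith.of_dist_le_mul
    intro x y
    rw [Real.dist_eq, Real.dist_eq, NNReal.coe_one, one_mul, abs_sub_comm]
    apply le_of_eq; congr 1; ring
  refine ⟨fun s => γ (1 - s), fun s => - a (1 - s), fun s => - b (1 - s), _, hγ.comp l1,
    by simp [h1], by simp [h0], ?_, ?_, ?_⟩
  · have := ae_comp_affine (-1) 1 (by norm_num) hd
    filter_upwards [this] with s hs hs'
    have e : (-1 * s + 1 : ℝ) = 1 - s := by ring
    rw [e] at hs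
    have := hs ⟨by linarith [hs'.2], by linarith [hs'.1]⟩
    have e1 : HasDerivAt (fun s : ℝ => 1 - s) (-1) s := by
      simpa using (hasDerivAt_id s).const_sub 1
    have := HasDerivAt.scomp s this e1
    convert! this using 1
    simp
    ring
  · simp only [neg_sq]
    have := (hi.comp_sub_left 1).symm
    simpa using this
  · simp only [neg_sq]
    rw [hL, intervalIntegral.integral_comp_sub_left (fun s => √(a s^2 + b s^2)) 1]
    simp

lemma reach_seg (x y : ℝ) : Reach HO (x, y, 0) (√(x^2+y^2)) := by
  have l1 := lip_mul x LipschitzWith.id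
  have l2 := lip_mul y LipschitzWith.id
  have l3 := LipschitzWith.const (α := ℝ) (0:ℝ)
  refine ⟨fun s => (x * s, y * s, 0), fun _ => x, fun _ => y, _, l1.prodMk (l2.prodMk l3),
    by simp [HO], by simp, ?_, by simp, by simp⟩
  filter_upwards with s _
  have := ((hasDerivAt_id s).const_mul x).prodMk (((hasDerivAt_id s).const_mul y).prodMk
    (hasDerivAt_const s (0:ℝ)))
  convert! this using 1
  simp
  ring

lemma reach_trans {P Q R : H} {L M : ℝ} (h : Reach P Q L) (h' : Reach Q R M) :
    Reach P R (L + M) := by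
  obtain ⟨γ, a, b, K, hγ, h0, h1, hd, hi, hL⟩ := h
  obtain ⟨γ', a', b', K', hγ', h0', h1', hd', hi', hL'⟩ := h'
  have l0 : LipschitzWith (‖(2:ℝ)‖₊ * 1) (fun s : ℝ => 2 * s) := lip_mul 2 LipschitzWith.id
  have l1 : LipschitzWith (‖(2:ℝ)‖₊ * 1) (fun s : ℝ => min (2 * s) 1) := l0.min_const 1
  have l2' : LipschitzWith (‖(2:ℝ)‖₊ * 1 + 0) (fun s : ℝ => 2 * s - 1) :=
    l0.sub (LipschitzWith.const 1)
  have l2 : LipschitzWith (‖(2:ℝ)‖₊ * 1 + 0) (fun s : ℝ => max (2 * s - 1) 0) := l2'.max_const 0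
  set G : ℝ → H := fun s => γ (min (2 * s) 1) + γ' (max (2 * s - 1) 0) - Q with hG
  have lG := ((hγ.comp l1).add (hγ'.comp l2)).sub (LipschitzWith.const Q)
  have G1 : ∀ s ≤ 1/2, G s = γ (2 * s) := by
    intro s hs
    simp only [hG]
    rw [min_eq_left (by linarith), max_eq_right (by linarith), h0']; simp
  have G2 : ∀ s, 1/2 ≤ s → G s = γ' (2 * s - 1) := by
    intro s hs
    simp only [hG]
    rw [min_eq_right (by linarith), max_eq_left (by linarith), h1]; simp
  set A : ℝ → ℝ := fun s => if s ≤ 1/2 then 2 * a (2 * s) else 2 * a' (2 * s - 1) with hA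
  set B : ℝ → ℝ := fun s => if s ≤ 1/2 then 2 * b (2 * s) else 2 * b' (2 * s - 1) with hB
  have S1 : ∀ s ≤ 1/2, √(A s^2 + B s^2) = 2 * √(a (2*s)^2 + b (2*s)^2) := by
    intro s hs
    simp only [hA, hB, if_pos hs]
    rw [show (2 * a (2*s))^2 + (2 * b (2*s))^2 = 2^2 * (a (2*s)^2 + b (2*s)^2) by ring,
      Real.sqrt_mul (by positivity), Real.sqrt_sq (by norm_num)]
  have S2 : ∀ s, 1/2 < s → √(A s^2 + B s^2) = 2 * √(a' (2*s-1)^2 + b' (2*s-1)^2) := by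
    intro s hs
    simp only [hA, hB, if_neg hs.not_ge]
    rw [show (2 * a' (2*s-1))^2 + (2 * b' (2*s-1))^2 = 2^2 * (a' (2*s-1)^2 + b' (2*s-1)^2) by ring,
      Real.sqrt_mul (by positivity), Real.sqrt_sq (by norm_num)]
  have I1 : IntervalIntegrable (fun s => √(A s^2 + B s^2)) volume 0 (1/2) := by
    have := (hi.comp_mul_left (c := 2)).const_mul 2
    simp only [zero_div] at this
    refine this.congr_ae ?_
    rw [Set.uIoc_of_le (by norm_num)]
    filter_upwards [ae_restrict_mem measurableSet_Ioc] with s hs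
    exact (S1 s hs.2).symm
  have I2 : IntervalIntegrable (fun s => √(A s^2 + B s^2)) volume (1/2) 1 := by
    have := (((hi'.comp_sub_right 1)).comp_mul_left (c := 2)).const_mul 2
    norm_num at this
    refine this.congr_ae ?_
    rw [Set.uIoc_of_le (by norm_num)]
    filter_upwards [ae_restrict_mem measurableSet_Ioc] with s hs
    exact (S2 s hs.1).symm
  refine ⟨G, A, B, _, lG, ?_, ?_, ?_, I1.trans I2, ?_⟩
  · rw [G1 0 (by norm_num)]; simpa using h0
  · rw [G2 1 (by norm_num)]; norm_num; exact h1'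
  · have d1 := ae_comp_affine 2 0 (by norm_num) hd
    have d2 := ae_comp_affine 2 (-1) (by norm_num) hd'
    have d3 : ∀ᵐ s : ℝ ∂volume, s ≠ 1/2 := by
      simp [ae_iff, measure_singleton]
    filter_upwards [d1, d2, d3] with s h1 h2 h3 hs
    rcases lt_or_gt_of_ne h3 with h | h
    · rw [add_zero] at h1
      have := h1 ⟨by linarith [hs.1], by linarith⟩
      have e1 : HasDerivAt (fun s : ℝ => 2 * s) 2 s := by
        simpa using (hasDerivAt_id s).const_mul 2
      have := HasDerivAt.scomp s this e1
      have := this.congr_of_eventuallyEq (f₁ := G) (by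
        filter_upwards [Iio_mem_nhds h] with u hu
        exact G1 u (le_of_lt hu))
      convert! this using 1
      rw [G1 s h.le]
      simp only [hA, hB, if_pos h.le]
      simp
      ring
    · rw [← sub_eq_add_neg] at h2
      have := h2 ⟨by linarith, by linarith [hs.2]⟩
      have e1 : HasDerivAt (fun s : ℝ => 2 * s - 1) 2 s := by
        simpa using ((hasDerivAt_id s).const_mul 2).sub_const 1
      have := HasDerivAt.scomp s this e1
      have := this.congr_of_eventuallyEq (f₁ := G) (by
        filter_upwards [Ioi_mem_nhds h] with u hu
        exact G2 u (le_of_lt hu))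
      convert! this using 1
      rw [G2 s h.le]
      simp only [hA, hB, if_neg h.not_ge]
      simp
      ring
  · rw [← intervalIntegral.integral_add_adjacent_intervals I1 I2]
    congr 1
    · rw [hL]
      symm
      rw [intervalIntegral.integral_congr_ae (g := fun s => 2 * √(a (2*s)^2 + b (2*s)^2))]
      · rw [intervalIntegral.integral_const_mul,
          intervalIntegral.integral_comp_mul_left (fun s => √(a s^2 + b s^2)) two_ne_zero]
        norm_num
        ring
      · filter_upwards with s hs
        rw [Set.uIoc_of_le (by norm_num)] at hs
        exact S1 s hs.2
    · rw [hL']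
      symm
      rw [intervalIntegral.integral_congr_ae
        (g := fun s => 2 * √(a' (2*s-1)^2 + b' (2*s-1)^2))]
      · rw [intervalIntegral.integral_const_mul,
          intervalIntegral.integral_comp_mul_sub (fun s => √(a' s^2 + b' s^2)) two_ne_zero]
        norm_num
        ring
      · filter_upwards with s hs
        rw [Set.uIoc_of_le (by norm_num)] at hs
        exact S2 s hs.1

lemma Hmul_assoc (P Q R : H) : Hmul (Hmul P Q) R = Hmul P (Hmul Q R) := by
  simp only [Hmul, Prod.mk.injEq]; refine ⟨by ring, by ring, by ring⟩

lemma Hmul_inv_self (P : H) : Hmul (Hinv P) P = HO := by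
  simp only [Hmul, Hinv, HO, Prod.mk.injEq]; refine ⟨by ring, by ring, by ring⟩

lemma Hmul_HO (P : H) : Hmul P HO = P := by
  simp [Hmul, HO]

lemma HO_Hmul (P : H) : Hmul HO P = P := by
  simp [Hmul, HO]

lemma Hmul_cancel (P Q : H) : Hmul P (Hmul (Hinv P) Q) = Q := by
  simp only [Hmul, Hinv]
  ext <;> simp
  ring

lemma reach_mul {P Q : H} {L M : ℝ} (h : Reach HO P L) (h' : Reach HO Q M) :
    Reach HO (Hmul P Q) (L + M) := by
  have := reach_left P h'
  rw [Hmul_HO] at this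
  exact reach_trans h this

lemma reach_vert (t : ℝ) : Reach HO (0, 0, t) (2 * √|t|) := by
  have key : ∀ a b : ℝ, Reach HO (0, 0, -4*a*b) (2 * |a| + 2 * |b|) := by
    intro a b
    have h := reach_mul (reach_mul (reach_seg a 0) (reach_seg 0 b))
      (reach_mul (reach_seg (-a) 0) (reach_seg 0 (-b)))
    convert! h using 1
    · simp [Hmul]; ring
    · simp [Real.sqrt_sq_eq_abs]; ring
  have hs : √|t|^2 = |t| := Real.sq_sqrt (abs_nonneg t)
  have hn := Real.sqrt_nonneg |t|
  rcases le_total 0 t with h | h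
  · have := key (√|t|/2) (-√|t|/2)
    convert! this using 1
    · rw [abs_of_nonneg h] at *; simp; linarith
    · rw [abs_div, abs_div, abs_neg, abs_of_nonneg hn]; norm_num; ring
  · have := key (√|t|/2) (√|t|/2)
    convert! this using 1
    · rw [abs_of_nonpos h] at *; simp; linarith
    · rw [abs_div, abs_of_nonneg hn]; norm_num; ring

lemma reach_any (x y t : ℝ) : Reach HO (x, y, t) (√(x^2+y^2) + 2 * √|t|) := by
  have := reach_mul (reach_seg x y) (reach_vert t)
  convert! this using 1
  simp [Hmul]

lemma reach_ex (P Q : H) : ∃ L, Reach P Q L := by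
  have := reach_left P (reach_any (Hmul (Hinv P) Q).1 (Hmul (Hinv P) Q).2.1 (Hmul (Hinv P) Q).2.2)
  rw [Hmul_HO] at this
  exact ⟨_, cast (congrArg (fun X => Reach P X _) (Hmul_cancel P Q)) this⟩

lemma dH_le {P Q : H} {L : ℝ} (h : Reach P Q L) : dH P Q ≤ L :=
  csInf_le ⟨0, fun _ h => reach_nonneg h⟩ h

lemma le_dH {P Q : H} {c : ℝ} (h : ∀ L, Reach P Q L → c ≤ L) : c ≤ dH P Q :=
  le_csInf (reach_ex P Q) h

lemma dH_nonneg (P Q : H) : 0 ≤ dH P Q := le_dH fun _ h => reach_nonneg h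

lemma dH_symm (P Q : H) : dH P Q = dH Q P :=
  le_antisymm (le_dH fun _ h => dH_le (reach_symm h)) (le_dH fun _ h => dH_le (reach_symm h))

lemma dH_triangle (P Q R : H) : dH P R ≤ dH P Q + dH Q R := by
  have : dH P R - dH Q R ≤ dH P Q := by
    apply le_dH
    intro L hL
    have : dH P R - L ≤ dH Q R := by
      apply le_dH
      intro M hM
      linarith [dH_le (reach_trans hL hM)]
    linarith
  linarith

lemma dH_left (A P Q : H) : dH (Hmul A P) (Hmul A Q) = dH P Q := by
  apply le_antisymm
  · exact le_dH fun _ h => dH_le (reach_left A h)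
  · refine le_dH fun _ h => dH_le ?_
    have := reach_left (Hinv A) h
    simpa only [← Hmul_assoc, Hmul_inv_self, HO_Hmul] using this

/-- gauge -/
def NH (P : H) : ℝ := dH HO P

lemma dH_NH (P Q : H) : dH P Q = NH (Hmul (Hinv P) Q) := by
  rw [NH, ← dH_left (Hinv P) P Q, Hmul_inv_self]

lemma NH_nonneg (P : H) : 0 ≤ NH P := dH_nonneg _ _

lemma NH_mul (P Q : H) : NH (Hmul P Q) ≤ NH P + NH Q := by
  have := dH_triangle HO P (Hmul P Q)
  have h2 := dH_left P HO Q
  rw [Hmul_HO] at h2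
  rwa [h2] at this

lemma NH_inv (P : H) : NH (Hinv P) = NH P := by
  have h := dH_left (Hinv P) P HO
  rw [Hmul_inv_self, Hmul_HO, dH_symm P HO] at h
  exact h

lemma NH_dil_le (r : ℝ) (hr : 0 ≤ r) (P : H) : NH (Hdil r P) ≤ r * NH P := by
  rcases hr.eq_or_lt with rfl | hr
  · have : NH (Hdil 0 P) ≤ _ := dH_le (reach_any (0*P.1) (0*P.2.1) (0^2*P.2.2))
    simpa using this
  have : NH (Hdil r P) / r ≤ NH P := by
    apply le_dH
    intro L hL
    rw [div_le_iff₀ hr, mul_comm]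
    apply dH_le
    have := reach_dil r hr.le hL
    simpa [Hdil, HO] using this
  rwa [div_le_iff₀ hr, mul_comm] at this

lemma NH_dil (r : ℝ) (hr : 0 ≤ r) (P : H) : NH (Hdil r P) = r * NH P := by
  apply le_antisymm (NH_dil_le r hr P)
  rcases hr.eq_or_lt with rfl | hr
  · simpa using NH_nonneg _
  have := NH_dil_le r⁻¹ (by positivity) (Hdil r P)
  have e : Hdil r⁻¹ (Hdil r P) = P := by
    simp only [Hdil]; ext <;> simp <;> field_simp
  rw [e, inv_mul_eq_div, le_div_iff₀ hr] at this
  linarith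

lemma NH_low (P : H) : √(P.1^2 + P.2.1^2) ≤ NH P := le_dH fun _ h => (reach_lower h).1

lemma NH_t (P : H) : |P.2.2| ≤ 2 * NH P^2 := by
  have : √(|P.2.2|/2) ≤ NH P := by
    apply le_dH
    intro L hL
    rw [Real.sqrt_le_left (reach_nonneg hL)]
    linarith [(reach_lower hL).2]
  rw [Real.sqrt_le_left (NH_nonneg P)] at this
  linarith

lemma NH_up (x y t : ℝ) : NH (x, y, t) ≤ √(x^2+y^2) + 2 * √|t| := dH_le (reach_any x y t)

lemma NH_hor (x y : ℝ) : NH (x, y, 0) = √(x^2+y^2) :=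
  le_antisymm (dH_le (reach_seg x y)) (NH_low (x, y, 0))

lemma NH_vert (t : ℝ) : NH (0, 0, t) = NH (0, 0, 1) * √|t| := by
  have h : ∀ t : ℝ, 0 ≤ t → NH (0, 0, t) = NH (0, 0, 1) * √|t| := by
    intro t ht
    have := NH_dil (√t) (Real.sqrt_nonneg t) (0, 0, 1)
    simp only [Hdil, mul_zero, Real.sq_sqrt ht, mul_one] at this
    rw [this, abs_of_nonneg ht, mul_comm]
  rcases le_total 0 t with ht | ht
  · exact h t ht
  · have := h (-t) (by linarith)
    rw [abs_neg] at this
    rw [← this, ← NH_inv]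
    simp [Hinv]

lemma kap_bd : 7/10 ≤ NH (0, 0, 1) ∧ NH (0, 0, 1) ≤ 2 := by
  constructor
  · have := NH_t (0, 0, 1)
    simp at this
    nlinarith [NH_nonneg (0, 0, 1)]
  · have := NH_up 0 0 1
    simpa using this

/-- removing the horizontal part -/
lemma NH_split (x y t : ℝ) : |NH (x, y, t) - NH (0, 0, t)| ≤ √(x^2+y^2) := by
  have h1 := NH_mul (x, y, 0) (0, 0, t)
  have h2 := NH_mul (-x, -y, 0) (x, y, t)
  rw [NH_hor] at h1 h2
  have e1 : Hmul (x, y, 0) (0, 0, t) = (x, y, t) := by simp [Hmul]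
  have e2 : Hmul (-x, -y, 0) (x, y, t) = (0, 0, t) := by
    simp only [Hmul, Prod.mk.injEq]; refine ⟨by ring, by ring, by ring⟩
  rw [e1] at h1
  rw [e2, neg_sq, neg_sq] at h2
  rw [abs_le]; constructor <;> linarith

lemma NH_shift (x y τ t : ℝ) (hn : 0 < NH (x, y, τ)) (ht : 16 * |t| ≤ NH (x, y, τ)^2) :
    NH (x, y, τ + t) ≤ NH (x, y, τ) + 24 * |t| / NH (x, y, τ) := by
  set n := NH (x, y, τ) with hn'
  set w := √(x^2+y^2) with hw
  have hw0 : 0 ≤ w := Real.sqrt_nonneg _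
  have hw2 : w^2 = x^2+y^2 := Real.sq_sqrt (by positivity)
  rcases le_total (n/2) w with hc | hc
  · have hwp : 0 < w := by linarith
    set l := t / (4 * w^2) with hl
    have h1 := NH_mul (Hmul (-l*y, l*x, 0) (x, y, τ)) (l*y, -l*x, 0)
    have h2 := NH_mul (-l*y, l*x, 0) (x, y, τ)
    rw [NH_hor] at h1 h2
    have e1 : Hmul (Hmul (-l*y, l*x, 0) (x, y, τ)) (l*y, -l*x, 0) = (x, y, τ + t) := by
      simp only [Hmul, Prod.mk.injEq]
      refine ⟨by ring, by ring, ?_⟩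
      have : t = 4 * l * w^2 := by rw [hl]; field_simp
      rw [hw2] at this
      linarith
    have e2 : √((l*y)^2 + (-l*x)^2) = |l| * w := by
      rw [show (l*y)^2 + (-l*x)^2 = l^2 * (x^2+y^2) by ring, Real.sqrt_mul (by positivity),
        Real.sqrt_sq_eq_abs]
    have e3 : √((-l*y)^2 + (l*x)^2) = |l| * w := by
      rw [show (-l*y)^2 + (l*x)^2 = l^2 * (x^2+y^2) by ring, Real.sqrt_mul (by positivity),
        Real.sqrt_sq_eq_abs]
    rw [e1, e2] at h1
    rw [e3] at h2
    have e4 : |l| * w = |t| / (4 * w) := by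
      rw [hl, abs_div, abs_of_pos (show 0 < 4 * w^2 by positivity)]; field_simp
    have e5 : |t| / (4 * w) ≤ 12 * |t| / n := by
      rw [div_le_div_iff₀ (by positivity) hn]
      nlinarith [abs_nonneg t]
    have : 24 * |t| / n = 2 * (12 * |t| / n) := by ring
    linarith
  · have hu := NH_up x y τ
    have hτ : n^2/16 ≤ |τ| := by
      have h1 : n/4 ≤ √|τ| := by linarith
      have h2 := Real.sq_sqrt (abs_nonneg τ)
      nlinarith
    have hτ0 : 0 < |τ| := by nlinarith
    have hτn : τ ≠ 0 := abs_pos.mp hτ0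
    have hq : |t/τ| ≤ 16 * |t| / n^2 := by
      rw [abs_div, div_le_div_iff₀ hτ0 (by positivity)]
      nlinarith [abs_nonneg t]
    have hq1 : |t/τ| ≤ 1 := by
      refine hq.trans ?_
      rw [div_le_one (by positivity)]; exact ht
    have hq2 : 0 ≤ 1 + t/τ := by linarith [(abs_le.mp hq1).1]
    set r := √(1 + t/τ) with hr
    have hr0 : 0 ≤ r := Real.sqrt_nonneg _
    have hr2 : r^2 = 1 + t/τ := Real.sq_sqrt hq2
    have hr3 : |r - 1| ≤ |t/τ| := by
      have : t/τ = (r-1)*(r+1) := by linarith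
      rw [this, abs_mul, abs_of_nonneg (show 0 ≤ r+1 by linarith)]
      nlinarith [abs_nonneg (r-1)]
    have h1 := NH_mul (Hdil r (x, y, τ)) ((1-r)*x, (1-r)*y, 0)
    rw [NH_hor, NH_dil r hr0] at h1
    have e1 : Hmul (Hdil r (x, y, τ)) ((1-r)*x, (1-r)*y, 0) = (x, y, τ + t) := by
      simp only [Hmul, Hdil, Prod.mk.injEq]
      refine ⟨by ring, by ring, ?_⟩
      rw [hr2]; field_simp; ring
    have e2 : √(((1-r)*x)^2 + ((1-r)*y)^2) = |r-1| * w := by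
      rw [show ((1-r)*x)^2 + ((1-r)*y)^2 = (r-1)^2 * (x^2+y^2) by ring,
        Real.sqrt_mul (by positivity), Real.sqrt_sq_eq_abs]
    rw [e1, e2] at h1
    have h5 := le_abs_self (r-1)
    have h6 : |r-1| * n ≤ 16 * |t| / n := by
      have : 16 * |t| / n = 16 * |t| / n^2 * n := by field_simp
      rw [this]
      gcongr
      linarith
    have h7 : |r-1| * w ≤ |r-1| * n / 2 := by nlinarith [abs_nonneg (r-1)]
    have : 24 * |t| / n = 16 * |t| / n + (16 * |t| / n)/2 := by ring
    nlinarith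

lemma dH_dil (r : ℝ) (hr : 0 ≤ r) (P Q : H) : dH (Hdil r P) (Hdil r Q) = r * dH P Q := by
  rw [dH_NH, dH_NH, ← NH_dil r hr]
  congr 1
  simp only [Hmul, Hinv, Hdil, Prod.mk.injEq]
  refine ⟨by ring, by ring, by ring⟩

lemma bilip_mono {ε ε' : ℝ} (h0 : 0 ≤ ε) (h : ε ≤ ε') {f : H → H} (hf : IsBiLip ε f) :
    IsBiLip ε' f := by
  intro P Q
  have := dH_nonneg P Q
  obtain ⟨h1, h2⟩ := hf P Q
  constructor
  · refine le_trans ?_ h1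
    gcongr
  · refine h2.trans ?_
    gcongr

def cj (r : ℝ) (f : H → H) : H → H := fun P => Hdil r⁻¹ (f (Hdil r P))

lemma cj_bilip {r ε : ℝ} (hr : 0 < r) {f : H → H} (hf : IsBiLip ε f) : IsBiLip ε (cj r f) := by
  intro P Q
  obtain ⟨h1, h2⟩ := hf (Hdil r P) (Hdil r Q)
  rw [dH_dil r hr.le] at h1 h2
  simp only [cj]
  rw [dH_dil r⁻¹ (by positivity)]
  constructor
  · rw [inv_mul_eq_div r, le_div_iff₀ hr]; linarith
  · rw [inv_mul_eq_div r, div_le_iff₀ hr]; linarith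

lemma Hdil_HO (r : ℝ) : Hdil r HO = HO := by simp [Hdil, HO]

lemma Hdil_cancel {r : ℝ} (hr : 0 < r) (P : H) : Hdil r (Hdil r⁻¹ P) = P := by
  simp only [Hdil]; ext <;> simp <;> field_simp

lemma cj_HO (r : ℝ) {f : H → H} (h : f HO = HO) : cj r f HO = HO := by
  simp [cj, Hdil_HO, h]

lemma sqrt_le_abs_add (x y : ℝ) : √(x^2+y^2) ≤ |x| + |y| := by
  apply Real.sqrt_le_iff.mpr
  refine ⟨by positivity, ?_⟩
  nlinarith [sq_abs x, sq_abs y, mul_nonneg (abs_nonneg x) (abs_nonneg y)]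

lemma abs_le_sqrt1 (x y : ℝ) : |x| ≤ √(x^2+y^2) := Real.abs_le_sqrt (by nlinarith [sq_nonneg y])
lemma abs_le_sqrt2 (x y : ℝ) : |y| ≤ √(x^2+y^2) := Real.abs_le_sqrt (by nlinarith [sq_nonneg x])

lemma dH_coord (p q : H) : Hmul (Hinv p) q =
    (q.1 - p.1, q.2.1 - p.2.1, q.2.2 - p.2.2 + 2 * (p.1 * (q.2.1 - p.2.1) - p.2.1 * (q.1 - p.1))) := by
  simp only [Hmul, Hinv, Prod.mk.injEq]
  refine ⟨by ring, by ring, by ring⟩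

lemma dH_close (p q : H) (A h : ℝ) (h1 : |p.1| ≤ A) (h2 : |p.2.1| ≤ A)
    (d1 : |q.1 - p.1| ≤ h) (d2 : |q.2.1 - p.2.1| ≤ h) (d3 : |q.2.2 - p.2.2| ≤ h) :
    dH p q ≤ 2 * h + 2 * √((1 + 4 * A) * h) := by
  rw [dH_NH, dH_coord]
  refine (NH_up _ _ _).trans ?_
  have := sqrt_le_abs_add (q.1 - p.1) (q.2.1 - p.2.1)
  have hh : 0 ≤ h := (abs_nonneg _).trans d1
  have hT : |q.2.2 - p.2.2 + 2 * (p.1 * (q.2.1 - p.2.1) - p.2.1 * (q.1 - p.1))| ≤ (1 + 4 * A) * h := by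
    have e1 : |p.1 * (q.2.1 - p.2.1)| ≤ A * h := by
      rw [abs_mul]; gcongr; exact (abs_nonneg _).trans h1
    have e2 : |p.2.1 * (q.1 - p.1)| ≤ A * h := by
      rw [abs_mul]; gcongr; exact (abs_nonneg _).trans h2
    rw [abs_le] at *
    constructor <;> nlinarith
  have := Real.sqrt_le_sqrt hT
  linarith

lemma iter_bd {ε : ℝ} (h0 : 0 ≤ ε) {f : H → H} (hf : IsBiLip ε f) (k : ℕ) (P Q : H) :
    dH P Q ≤ (1+ε)^k * dH (f^[k] P) (f^[k] Q) ∧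
    dH (f^[k] P) (f^[k] Q) ≤ (1+ε)^k * dH P Q := by
  induction k with
  | zero => simp
  | succ k ih =>
    rw [Function.iterate_succ_apply', Function.iterate_succ_apply']
    obtain ⟨a, b⟩ := hf (f^[k] P) (f^[k] Q)
    rw [inv_mul_le_iff₀ (by positivity)] at a
    constructor
    · refine ih.1.trans ?_
      rw [pow_succ, mul_assoc]; gcongr
    · refine b.trans ?_
      rw [pow_succ', mul_assoc]; gcongr
      exact ih.2

lemma dense1 (δ : ℝ) (h0 : 0 < δ) (h1 : δ ≤ 1/2) (f : H → H) (hf : IsBiLip (δ^12) f)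
    (hO : f HO = HO) (x : H) (hx : NH x ≤ 1) : ∃ Q, dH (f Q) x ≤ 1200 * δ^2 := by
  set D := (δ^4)⁻¹ with hD
  have hD1 : D * δ^4 = 1 := by rw [hD]; field_simp
  have hδ4 : δ^4 ≤ 1/16 := by
    calc δ^4 ≤ (1/2)^4 := by gcongr
      _ = 1/16 := by norm_num
  have hδ4p : 0 < δ^4 := by positivity
  have hD16 : 16 ≤ D := by
    rw [hD, le_inv_comm₀ (by norm_num) hδ4p]; linarith
  set M := ⌊D/4⌋₊ with hM
  have hM1 : (M:ℝ) ≤ D/4 := Nat.floor_le (by linarith)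
  have hM2 : D/4 < M + 1 := Nat.lt_floor_add_one _
  have hM3 : D/8 ≤ M := by linarith
  have hMp : (0:ℝ) < M := by linarith
  set K := (2*M+1)^3 with hK
  have hKD : (K:ℝ) * δ^12 ≤ 1 := by
    have e : (K:ℝ) ≤ D^3 := by
      rw [hK]; push_cast
      gcongr; linarith
    calc (K:ℝ) * δ^12 ≤ D^3 * δ^12 := by gcongr
      _ = (D*δ^4)^3 := by ring
      _ = 1 := by rw [hD1]; norm_num
  have hpw : ∀ k ≤ K, (1+δ^12)^k ≤ 3 := by
    intro k hk
    have e1 : 1 + δ^12 ≤ Real.exp (δ^12) := by linarith [Real.add_one_le_exp (δ^12)]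
    calc (1+δ^12)^k ≤ (Real.exp (δ^12))^k := by gcongr
      _ = Real.exp (k * δ^12) := by rw [← Real.exp_nat_mul]
      _ ≤ Real.exp 1 := by
        apply Real.exp_le_exp.mpr
        refine le_trans ?_ hKD
        gcongr
      _ ≤ 3 := by linarith [Real.exp_one_lt_d9]
  have hε : (0:ℝ) ≤ δ^12 := by positivity
  have hOk : ∀ k, f^[k] HO = HO := fun k => Function.iterate_fixed hO k
  have hN : ∀ k ≤ K, NH (f^[k] x) ≤ 3 := by
    intro k hk
    have := (iter_bd hε hf k HO x).2
    rw [hOk] at this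
    have h3 := hpw k hk
    have h4 : dH HO x ≤ 1 := hx
    have h5 := dH_nonneg HO x
    refine le_trans this ?_
    nlinarith
  have hc : ∀ k ≤ K, |(f^[k] x).1| ≤ 3 ∧ |(f^[k] x).2.1| ≤ 3 ∧ |(f^[k] x).2.2| ≤ 18 := by
    intro k hk
    have := hN k hk
    have l1 := NH_low (f^[k] x)
    have l2 := NH_t (f^[k] x)
    refine ⟨(abs_le_sqrt1 _ _).trans (l1.trans this), (abs_le_sqrt2 _ _).trans (l1.trans this), ?_⟩
    nlinarith [NH_nonneg (f^[k] x)]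
  have hcell : ∀ c : ℝ, |c| ≤ 18 → ⌊c * M / 18⌋ ∈ Finset.Icc (-(M:ℤ)) M := by
    intro c hc
    rw [abs_le] at hc
    rw [Finset.mem_Icc]
    constructor
    · rw [Int.le_floor]; push_cast; nlinarith
    · have : ⌊c * M / 18⌋ ≤ ⌊((M:ℤ):ℝ)⌋ := by
        apply Int.floor_le_floor; push_cast; nlinarith
      rwa [Int.floor_intCast] at this
  obtain ⟨i, hi, j, hj, hij, he⟩ := Finset.exists_ne_map_eq_of_card_lt_of_maps_to
    (s := Finset.range (K+1))
    (t := Finset.Icc (-(M:ℤ)) M ×ˢ (Finset.Icc (-(M:ℤ)) M ×ˢ Finset.Icc (-(M:ℤ)) M))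
    (f := fun k => (⌊(f^[k] x).1 * M / 18⌋, ⌊(f^[k] x).2.1 * M / 18⌋, ⌊(f^[k] x).2.2 * M / 18⌋))
    (by
      rw [Finset.card_product, Finset.card_product, Int.card_Icc, Finset.card_range]
      have : ((M:ℤ) + 1 - -(M:ℤ)).toNat = 2*M+1 := by omega
      rw [this, hK]
      have : (2*M+1)*((2*M+1)*(2*M+1)) = (2*M+1)^3 := by ring
      omega)
    (by
      intro k hk
      have hk' : k ≤ K := by
        have := Finset.mem_range.mp (Finset.mem_coe.mp hk); omega
      obtain ⟨a, b, c⟩ := hc k hk'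
      simp only [Finset.coe_product, Set.mem_prod, Finset.mem_coe]
      exact ⟨hcell _ (by linarith), hcell _ (by linarith), hcell _ c⟩)
  have main : ∀ i j : ℕ, i < j → j ≤ K →
      (⌊(f^[i] x).1 * M / 18⌋, ⌊(f^[i] x).2.1 * M / 18⌋, ⌊(f^[i] x).2.2 * M / 18⌋) =
      (⌊(f^[j] x).1 * M / 18⌋, ⌊(f^[j] x).2.1 * M / 18⌋, ⌊(f^[j] x).2.2 * M / 18⌋) →
      ∃ Q, dH (f Q) x ≤ 1200 * δ^2 := by
    intro i j hij hj he
    simp only [Prod.mk.injEq] at he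
    have hdiff : ∀ c d : ℝ, ⌊c * M / 18⌋ = ⌊d * M / 18⌋ → |d - c| ≤ 144 * δ^4 := by
      intro c d hcd
      have := Int.abs_sub_lt_one_of_floor_eq_floor hcd
      have e : c * M / 18 - d * M / 18 = (c - d) * (M/18) := by ring
      rw [e, abs_mul, abs_of_pos (show (0:ℝ) < M/18 by positivity), abs_sub_comm] at this
      have h5 : |d - c| * (D/8/18) ≤ 1 := by
        refine le_trans ?_ this.le
        gcongr
      calc |d - c| = |d - c| * (D * δ^4) := by rw [hD1, mul_one]
        _ = (|d - c| * (D/8/18)) * (144 * δ^4) := by ring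
        _ ≤ 1 * (144 * δ^4) := by gcongr
        _ = _ := one_mul _
    obtain ⟨c1, c2, c3⟩ := hc i (by omega)
    have hcl := dH_close (f^[i] x) (f^[j] x) 3 (144 * δ^4) c1 c2 (hdiff _ _ he.1)
      (hdiff _ _ he.2.1) (hdiff _ _ he.2.2)
    have hsq : √((1 + 4 * 3) * (144 * δ^4)) ≤ 44 * δ^2 := by
      apply Real.sqrt_le_iff.mpr
      refine ⟨by positivity, ?_⟩
      nlinarith
    have hδδ : δ^4 ≤ δ^2 := pow_le_pow_of_le_one h0.le (by linarith) (by norm_num)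
    obtain ⟨m, rfl⟩ : ∃ m, j = i + (m+1) := ⟨j - i - 1, by omega⟩
    have hb := (iter_bd hε hf i x (f^[m+1] x)).1
    rw [← Function.iterate_add_apply f i (m+1) x] at hb
    refine ⟨f^[m] x, ?_⟩
    rw [← Function.iterate_succ_apply' f m x, dH_symm]
    refine hb.trans ?_
    have h3 := hpw i (by omega)
    have h4 : dH (f^[i] x) (f^[i+(m+1)] x) ≤ 376 * δ^2 := by linarith
    have h5 := dH_nonneg (f^[i] x) (f^[i+(m+1)] x)
    have h6 : 0 < δ^2 := by positivity
    nlinarith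
  have hi' : i ≤ K := by have := Finset.mem_range.mp hi; omega
  have hj' : j ≤ K := by have := Finset.mem_range.mp hj; omega
  rcases lt_or_gt_of_ne hij with h | h
  · exact main i j h hj' he
  · exact main j i h hi' he.symm

lemma denseS (δ : ℝ) (h0 : 0 < δ) (h1 : δ ≤ 1/2) (f : H → H) (hf : IsBiLip (δ^12) f)
    (hO : f HO = HO) (S : ℝ) (hS : 0 < S) (x : H) (hx : NH x ≤ S) :
    ∃ Q, dH (f Q) x ≤ 1200 * δ^2 * S := by
  obtain ⟨Q, hQ⟩ := dense1 δ h0 h1 (cj S f) (cj_bilip hS hf) (cj_HO S hO) (Hdil S⁻¹ x) (by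
    rw [NH_dil _ (by positivity), inv_mul_le_iff₀ hS]; linarith)
  refine ⟨Hdil S Q, ?_⟩
  simp only [cj] at hQ
  rw [dH_dil _ (by positivity), inv_mul_le_iff₀ hS] at hQ
  linarith

set_option maxHeartbeats 1000000 in
lemma main1 (δ : ℝ) (h0 : 0 < δ) (h1 : δ ≤ 1/1000000) (f : H → H) (hf : IsBiLip (δ^12) f)
    (hO : f HO = HO) (t : ℝ) (ht : |t| = 1) :
    √((f (0,0,t)).1^2 + (f (0,0,t)).2.1^2) ≤ 3400 * δ := by
  set P' := f (0,0,t) with hP'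
  set z := √(P'.1^2 + P'.2.1^2) with hz
  have hz0 : 0 ≤ z := Real.sqrt_nonneg _
  have hz2 : z^2 = P'.1^2 + P'.2.1^2 := Real.sq_sqrt (by positivity)
  rcases hz0.eq_or_lt with h | hzp
  · rw [← h]; positivity
  have hε2 : δ^12 ≤ δ^2 := pow_le_pow_of_le_one h0.le (by linarith) (by norm_num)
  set ε := δ^12 with hε
  have hε0 : 0 ≤ ε := by positivity
  have hεs : ε ≤ 1/1000000 := by nlinarith
  set S := δ⁻¹ with hS
  have hSδ : S * δ = 1 := by rw [hS]; field_simp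
  have hSp : 0 < S := by positivity
  have hSb : 1000000 ≤ S := by
    rw [hS, le_inv_comm₀ (by norm_num) h0]; linarith
  have hεS : ε * S ≤ δ := by
    calc ε * S ≤ δ^2 * S := by gcongr
      _ = δ * (S * δ) := by ring
      _ = δ := by rw [hSδ, mul_one]
  -- bounds on P'
  have hNP : NH (0,0,t) ≤ 2 := by
    have := NH_up 0 0 t
    rw [ht] at this; simpa using this
  have hNP' : NH P' ≤ 3 := by
    have := (hf HO (0,0,t)).2
    rw [hO] at this
    have h5 : dH HO (0,0,t) ≤ 2 := hNP
    refine le_trans this ?_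
    nlinarith
  have hz3 : z ≤ 3 := (NH_low P').trans hNP'
  have ht' : |P'.2.2| ≤ 18 := by
    have := NH_t P'
    nlinarith [NH_nonneg P']
  -- the far point
  set X : H := (S * (P'.1 / z), S * (P'.2.1 / z), 0) with hX
  have hNX : NH X = S := by
    rw [hX, NH_hor]
    rw [show (S * (P'.1 / z))^2 + (S * (P'.2.1 / z))^2 = S^2 by
      field_simp; rw [hz2]]
    exact Real.sqrt_sq hSp.le
  obtain ⟨Q, hQ⟩ := denseS δ h0 (by linarith) f hf hO S hSp X hNX.le
  have hQ' : dH (f Q) X ≤ 1200 * δ := by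
    refine hQ.trans (le_of_eq ?_)
    calc 1200 * δ^2 * S = 1200 * δ * (S * δ) := by ring
      _ = _ := by rw [hSδ, mul_one]
  -- n
  set n := NH Q with hn
  have hfQ1 : S - 1200 * δ ≤ dH HO (f Q) := by
    have := dH_triangle HO (f Q) X
    have e : dH HO X = S := hNX
    linarith
  have hfQ2 : dH HO (f Q) ≤ S + 1200 * δ := by
    have := dH_triangle HO X (f Q)
    have e : dH HO X = S := hNX
    rw [dH_symm X] at this
    linarith
  have hb := hf HO Q
  rw [hO] at hb
  have hbn : dH HO Q = n := rfl
  rw [hbn, inv_mul_le_iff₀ (by positivity)] at hb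
  have hn1 : S - 1201 * δ ≤ n := by
    have h5 : dH HO (f Q) ≤ (1+ε) * n := hb.2
    have h6 : S - 1200 * δ ≤ (1+ε) * n := by linarith
    by_contra hcon
    push Not at hcon
    nlinarith
  have hn2 : n ≤ 2 * S - 2 := by
    have h5 := hb.1
    nlinarith
  -- m
  set m := dH (0,0,t) Q with hm
  have hmn : n ≤ m + 2 := by
    have := dH_triangle HO (0,0,t) Q
    have e : dH HO (0,0,t) ≤ 2 := hNP
    linarith
  have hmn2 : m ≤ n + 2 := by
    have := dH_triangle (0,0,t) HO Q
    rw [dH_symm _ HO] at this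
    have e : dH HO (0,0,t) ≤ 2 := hNP
    linarith
  have hmS : S/2 ≤ m := by linarith
  have hmN : m = NH (Q.1, Q.2.1, Q.2.2 - t) := by
    rw [hm, dH_NH, dH_coord]; simp
  have hsh : n ≤ m + 24 / m := by
    have := NH_shift Q.1 Q.2.1 (Q.2.2 - t) t (by rw [← hmN]; linarith)
      (by rw [← hmN, ht]; nlinarith)
    rw [← hmN, ht, sub_add_cancel, mul_one] at this
    exact this
  have h24 : 24 / m ≤ 48 * δ := by
    rw [div_le_iff₀ (by linarith)]
    nlinarith
  have hlow : S - 2451 * δ ≤ dH P' X := by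
    have h5 := (hf (0,0,t) Q).1
    rw [inv_mul_le_iff₀ (by positivity)] at h5
    have h6 := dH_triangle P' X (f Q)
    rw [dH_symm X] at h6
    have h7 : m ≤ (1+ε) * dH P' (f Q) := h5
    have h8 : m - 2 * δ ≤ dH P' (f Q) := by
      by_contra hcon
      push Not at hcon
      have g1 : m ≤ 2 * S := by linarith
      have g2 : dH P' (f Q) ≤ 2 * S := by linarith
      have g3 : ε * dH P' (f Q) ≤ ε * (2 * S) := mul_le_mul_of_nonneg_left g2 hε0
      have g4 : ε * (2 * S) ≤ 2 * δ := by linarith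
      have g5 : (1+ε) * dH P' (f Q) = dH P' (f Q) + ε * dH P' (f Q) := by ring
      linarith
    linarith
  -- upper bound
  have hup : dH P' X ≤ (S - z) + 864 * δ := by
    have e : Hmul (Hinv P') X = ((S-z) * (P'.1/z), (S-z) * (P'.2.1/z), 0 + -P'.2.2) := by
      rw [dH_coord, hX]
      simp only [Prod.mk.injEq]
      refine ⟨by field_simp, by field_simp, by field_simp; ring⟩
    have eN : NH ((S-z) * (P'.1/z), (S-z) * (P'.2.1/z), 0) = S - z := by
      rw [NH_hor]
      rw [show ((S-z) * (P'.1 / z))^2 + ((S-z) * (P'.2.1 / z))^2 = (S-z)^2 by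
        field_simp; rw [hz2]; ring]
      exact Real.sqrt_sq (by linarith)
    rw [dH_NH, e]
    have := NH_shift ((S-z) * (P'.1/z)) ((S-z) * (P'.2.1/z)) 0 (-P'.2.2)
      (by rw [eN]; linarith) (by rw [eN, abs_neg]; nlinarith)
    rw [eN, abs_neg] at this
    refine this.trans ?_
    gcongr
    rw [div_le_iff₀ (by linarith)]
    nlinarith
  linarith

lemma main2 (δ : ℝ) (h0 : 0 < δ) (h1 : δ ≤ 1/1000000) (f : H → H) (hf : IsBiLip (δ^12) f)
    (hO : f HO = HO) (t : ℝ) (ht : |t| = 1) :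
    |(|(f (0,0,t)).2.2| - 1)| ≤ 15000 * δ := by
  have hz := main1 δ h0 h1 f hf hO t ht
  have hε2 : δ^12 ≤ δ := by
    simpa using pow_le_pow_of_le_one h0.le (by linarith) (show 1 ≤ 12 by norm_num)
  have hε0 : 0 ≤ δ^12 := by positivity
  set P' := f (0,0,t) with hP'
  obtain ⟨k1, k2⟩ := kap_bd
  have hv := NH_vert t
  rw [ht, Real.sqrt_one, mul_one] at hv
  set κ := NH (0,0,1) with hκ
  have hb := hf HO (0,0,t)
  rw [hO] at hb
  have e1 : dH HO (0,0,t) = κ := hv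
  have e2 : dH HO (f (0,0,t)) = NH P' := rfl
  rw [e1, e2, inv_mul_le_iff₀ (by positivity)] at hb
  have hs := NH_split P'.1 P'.2.1 P'.2.2
  have e3 : NH (P'.1, P'.2.1, P'.2.2) = NH P' := rfl
  rw [e3, NH_vert P'.2.2, ← hκ] at hs
  set w := √|P'.2.2| with hw
  have hw0 : 0 ≤ w := Real.sqrt_nonneg _
  have hw2 : w^2 = |P'.2.2| := Real.sq_sqrt (abs_nonneg _)
  rw [← hw2]
  have hs' := hs.trans hz
  rw [abs_le] at hs' ⊢
  have a1 : NH P' ≤ κ + 2 * δ := by nlinarith [hb.2]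
  have a2 : κ - 2 * δ ≤ NH P' := by
    by_contra hcon
    push Not at hcon
    nlinarith [hb.1]
  have b1 : w - 1 ≤ 4900 * δ := by
    by_contra hcon
    push Not at hcon
    nlinarith
  have b2 : -(4900 * δ) ≤ w - 1 := by
    by_contra hcon
    push Not at hcon
    nlinarith
  constructor <;> nlinarith

lemma key (δ : ℝ) (h0 : 0 < δ) (h1 : δ ≤ 1/1000000) (f : H → H) (hf : IsBiLip (δ^12) f)
    (hO : f HO = HO) (t : ℝ) :
    √((f (0,0,t)).1^2 + (f (0,0,t)).2.1^2) ≤ 3400 * δ * √|t| ∧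
    |(|(f (0,0,t)).2.2| - |t|)| ≤ 15000 * δ * |t| := by
  by_cases ht : t = 0
  · subst ht
    have : f (0,0,0) = HO := hO
    rw [this]; simp [HO]
  set r := √|t| with hr
  have htp : 0 < |t| := abs_pos.mpr ht
  have hrp : 0 < r := Real.sqrt_pos.mpr htp
  have hr2 : r^2 = |t| := Real.sq_sqrt htp.le
  have hu : |t / r^2| = 1 := by
    rw [hr2, abs_div, abs_abs, div_self htp.ne']
  have m1 := main1 δ h0 h1 (cj r f) (cj_bilip hrp hf) (cj_HO r hO) (t / r^2) hu
  have m2 := main2 δ h0 h1 (cj r f) (cj_bilip hrp hf) (cj_HO r hO) (t / r^2) hu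
  have e : cj r f (0, 0, t / r^2) = Hdil r⁻¹ (f (0,0,t)) := by
    simp only [cj]
    congr 2
    simp only [Hdil, mul_zero]
    congr 2
    field_simp
  rw [e] at m1 m2
  simp only [Hdil] at m1 m2
  rw [show (r⁻¹ * (f (0,0,t)).1)^2 + (r⁻¹ * (f (0,0,t)).2.1)^2
    = (r⁻¹)^2 * ((f (0,0,t)).1^2 + (f (0,0,t)).2.1^2) by ring, Real.sqrt_mul (by positivity),
    Real.sqrt_sq (by positivity), inv_mul_le_iff₀ hrp] at m1
  constructor
  · linarith
  · rw [abs_mul, abs_of_pos (show 0 < r⁻¹^2 by positivity)] at m2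
    have e2 : r⁻¹^2 * |(f (0,0,t)).2.2| - 1 = (r^2)⁻¹ * (|(f (0,0,t)).2.2| - r^2) := by
      field_simp
    rw [e2, abs_mul, abs_of_pos (show 0 < (r^2)⁻¹ by positivity),
      inv_mul_le_iff₀ (by positivity), hr2] at m2
    linarith

lemma absbd {p : H} {A : ℝ} (h : √(p.1^2+p.2.1^2) ≤ A) : |p.1| ≤ A ∧ |p.2.1| ≤ A :=
  ⟨(abs_le_sqrt1 _ _).trans h, (abs_le_sqrt2 _ _).trans h⟩

lemma axis_dist (s t : ℝ) : dH (0,0,s) (0,0,t) = NH (0,0,1) * √|t - s| := by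
  rw [dH_NH, dH_coord, ← NH_vert]; simp

lemma tbd (p q : H) (h1 : |p.1| ≤ 1/100) (h2 : |p.2.1| ≤ 1/100) (h3 : |q.1| ≤ 1/100)
    (h4 : |q.2.1| ≤ 1/100) :
    |2*(p.1*(q.2.1-p.2.1) - p.2.1*(q.1-p.1))| ≤ 1/1000 := by
  rw [show 2*(p.1*(q.2.1-p.2.1) - p.2.1*(q.1-p.1)) = 2 * (p.1 * q.2.1) - 2 * (p.2.1 * q.1) by ring]
  have a1 : |p.1 * q.2.1| ≤ 1/100 * (1/100) := by
    rw [abs_mul]; gcongr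
  have a2 : |p.2.1 * q.1| ≤ 1/100 * (1/100) := by
    rw [abs_mul]; gcongr
  rw [abs_le] at *
  constructor <;> linarith [a1.1, a1.2, a2.1, a2.2]

lemma sign1 (f : H → H) (hf : IsBiLip ((1/1000000)^12) f) (hO : f HO = HO) (s : ℝ)
    (hs : 1/2 ≤ s) (hs1 : s ≤ 1) : 0 < (f (0,0,1)).2.2 * (f (0,0,s)).2.2 := by
  obtain ⟨a1, a2⟩ := key (1/1000000) (by norm_num) le_rfl f hf hO 1
  obtain ⟨b1, b2⟩ := key (1/1000000) (by norm_num) le_rfl f hf hO s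
  have hb := (hf (0,0,1) (0,0,s)).2
  rw [axis_dist] at hb
  obtain ⟨k1, k2⟩ := kap_bd
  set κ := NH (0,0,1)
  set p := f (0,0,1)
  set q := f (0,0,s)
  rw [abs_one, Real.sqrt_one] at a1
  rw [abs_one] at a2
  have hs0 : √|s| ≤ 1 := by
    rw [Real.sqrt_le_left (by norm_num), abs_of_nonneg (by linarith)]; linarith
  have hs2 : √|s-1| ≤ 0.71 := by
    rw [Real.sqrt_le_left (by norm_num), abs_of_nonpos (by linarith)]; linarith
  rw [abs_of_nonneg (show 0 ≤ s by linarith)] at b2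
  obtain ⟨p1, p2⟩ := absbd (A := 0.0034) (p := p) (by linarith)
  obtain ⟨q1, q2⟩ := absbd (A := 0.0034) (p := q) (by nlinarith)
  have ht := tbd p q (by linarith) (by linarith) (by linarith) (by linarith)
  by_contra hcon
  push Not at hcon
  have hd : |q.2.2 - p.2.2| = |q.2.2| + |p.2.2| := by
    rcases le_total 0 p.2.2 with h | h <;> rcases le_total 0 q.2.2 with h' | h'
    · have : p.2.2 = 0 ∨ q.2.2 = 0 := by
        rw [← mul_eq_zero]; exact le_antisymm hcon (mul_nonneg h h')
      rcases this with e | e <;> rw [e] <;> simp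
    · rw [abs_of_nonneg h, abs_of_nonpos h', abs_of_nonpos (by linarith)]; ring
    · rw [abs_of_nonpos h, abs_of_nonneg h', abs_of_nonneg (by linarith)]; ring
    · have : p.2.2 = 0 ∨ q.2.2 = 0 := by
        rw [← mul_eq_zero]; exact le_antisymm hcon (mul_nonneg_of_nonpos_of_nonpos h h')
      rcases this with e | e <;> rw [e] <;> simp
  set E := 2*(p.1*(q.2.1-p.2.1) - p.2.1*(q.1-p.1)) with hE
  have hT : 1.44 ≤ |q.2.2 - p.2.2 + E| := by
    have := abs_sub_abs_le_abs_sub (q.2.2 - p.2.2) (-E)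
    rw [abs_neg, sub_neg_eq_add, hd] at this
    rw [abs_le] at a2 b2
    linarith [a2.1, b2.1]
  have hT' : 1.2 ≤ √|q.2.2 - p.2.2 + E| := by
    apply Real.le_sqrt_of_sq_le; linarith
  have hsp := NH_split (q.1-p.1) (q.2.1-p.2.1) (q.2.2-p.2.2+E)
  rw [NH_vert] at hsp
  rw [dH_NH, dH_coord] at hb
  have h5 := sqrt_le_abs_add (q.1-p.1) (q.2.1-p.2.1)
  have h6 := abs_sub q.1 p.1
  have h7 := abs_sub q.2.1 p.2.1
  have h8 := (abs_le.mp hsp).1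
  have h9 : κ * 1.2 ≤ κ * √|q.2.2 - p.2.2 + E| := by gcongr
  have h10 : κ * √|s-1| ≤ κ * 0.71 := by gcongr
  have h11 : 0 ≤ κ * √|s-1| := by positivity
  have h12 : (1 + (1/1000000:ℝ)^12) * (κ * √|s-1|) ≤ 1.1 * (κ * 0.71) := by
    apply mul_le_mul _ h10 h11 (by norm_num)
    norm_num
  linarith

lemma sign2 (f : H → H) (hf : IsBiLip ((1/1000000)^12) f) (hO : f HO = HO) :
    (f (0,0,1)).2.2 * (f (0,0,-1)).2.2 < 0 := by
  obtain ⟨a1, a2⟩ := key (1/1000000) (by norm_num) le_rfl f hf hO 1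
  obtain ⟨b1, b2⟩ := key (1/1000000) (by norm_num) le_rfl f hf hO (-1)
  have hb := (hf (0,0,1) (0,0,-1)).1
  rw [axis_dist, inv_mul_le_iff₀ (by norm_num)] at hb
  obtain ⟨k1, k2⟩ := kap_bd
  set κ := NH (0,0,1)
  set p := f (0,0,1)
  set q := f (0,0,-1)
  rw [abs_one, Real.sqrt_one] at a1
  rw [abs_one] at a2
  rw [abs_neg, abs_one, Real.sqrt_one] at b1
  rw [abs_neg, abs_one] at b2
  have hs2 : 1.4 ≤ √|(-1)-(1:ℝ)| := by
    apply Real.le_sqrt_of_sq_le; norm_num [abs_of_nonpos]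
  obtain ⟨p1, p2⟩ := absbd (A := 0.0034) (p := p) (by linarith)
  obtain ⟨q1, q2⟩ := absbd (A := 0.0034) (p := q) (by linarith)
  have ht := tbd p q (by linarith) (by linarith) (by linarith) (by linarith)
  by_contra hcon
  push Not at hcon
  have hd : |q.2.2 - p.2.2| ≤ 0.03 := by
    rw [abs_le] at a2 b2
    rcases le_total 0 p.2.2 with h | h <;> rcases le_total 0 q.2.2 with h' | h'
    · rw [abs_of_nonneg h] at a2
      rw [abs_of_nonneg h'] at b2
      rw [abs_le]; constructor <;> linarith [a2.1, a2.2, b2.1, b2.2]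
    · exfalso
      rw [abs_of_nonneg h] at a2
      rw [abs_of_nonpos h'] at b2
      nlinarith [a2.1, a2.2, b2.1, b2.2]
    · exfalso
      rw [abs_of_nonpos h] at a2
      rw [abs_of_nonneg h'] at b2
      nlinarith [a2.1, a2.2, b2.1, b2.2]
    · rw [abs_of_nonpos h] at a2
      rw [abs_of_nonpos h'] at b2
      rw [abs_le]; constructor <;> linarith [a2.1, a2.2, b2.1, b2.2]
  set E := 2*(p.1*(q.2.1-p.2.1) - p.2.1*(q.1-p.1)) with hE
  have hT : |q.2.2 - p.2.2 + E| ≤ 0.04 := by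
    have := abs_add_le (q.2.2 - p.2.2) E
    linarith
  have hT' : √|q.2.2 - p.2.2 + E| ≤ 0.2 := by
    rw [Real.sqrt_le_left (by norm_num)]; linarith
  have hup := NH_up (q.1-p.1) (q.2.1-p.2.1) (q.2.2-p.2.2+E)
  rw [dH_NH, dH_coord] at hb
  have h5 := sqrt_le_abs_add (q.1-p.1) (q.2.1-p.2.1)
  have h6 := abs_sub q.1 p.1
  have h7 := abs_sub q.2.1 p.2.1
  have h9 : 0.7 * 1.4 ≤ κ * √|(-1)-(1:ℝ)| := by
    apply mul_le_mul _ hs2 (by norm_num) (by linarith); linarith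
  have h12 : (1 + (1/1000000:ℝ)^12) * NH (q.1-p.1, q.2.1-p.2.1, q.2.2-p.2.2+E) ≤ 1.1 * 0.5 := by
    apply mul_le_mul _ _ (NH_nonneg _) (by norm_num)
    · norm_num
    · linarith
  linarith

lemma cj_axis {r : ℝ} (f : H → H) (t : ℝ) :
    (cj r f (0,0,t)).2.2 = (r⁻¹)^2 * (f (0,0,r^2*t)).2.2 := by
  simp [cj, Hdil]

lemma sign3 (f : H → H) (hf : IsBiLip ((1/1000000)^12) f) (hO : f HO = HO) (t s : ℝ)
    (h0 : 0 < t) (hs : t/2 ≤ s) (hs1 : s ≤ t) : 0 < (f (0,0,t)).2.2 * (f (0,0,s)).2.2 := by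
  have hr : 0 < √t := Real.sqrt_pos.mpr h0
  have h := sign1 (cj (√t) f) (cj_bilip hr hf) (cj_HO _ hO) (s/t)
    (by rw [le_div_iff₀ h0]; linarith) (by rw [div_le_iff₀ h0]; linarith)
  rw [cj_axis, cj_axis, Real.sq_sqrt h0.le, mul_one, mul_div_cancel₀ _ h0.ne'] at h
  have h2 : 0 < ((√t)⁻¹)^2 := by positivity
  by_contra hcon
  push Not at hcon
  nlinarith [mul_pos h2 h2]

lemma sign4 (f : H → H) (hf : IsBiLip ((1/1000000)^12) f) (hO : f HO = HO) (t : ℝ)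
    (h0 : 0 < t) : (f (0,0,t)).2.2 * (f (0,0,-t)).2.2 < 0 := by
  have hr : 0 < √t := Real.sqrt_pos.mpr h0
  have h := sign2 (cj (√t) f) (cj_bilip hr hf) (cj_HO _ hO)
  rw [cj_axis, cj_axis, Real.sq_sqrt h0.le, mul_one, mul_neg, mul_one] at h
  have h2 : 0 < ((√t)⁻¹)^2 := by positivity
  by_contra hcon
  push Not at hcon
  nlinarith [mul_pos h2 h2]

lemma sign5 (f : H → H) (hf : IsBiLip ((1/1000000)^12) f) (hO : f HO = HO) (n : ℕ) :
    ∀ t s : ℝ, 0 < t → t/2^n ≤ s → s ≤ t → 0 < (f (0,0,t)).2.2 * (f (0,0,s)).2.2 := by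
  induction n with
  | zero =>
    intro t s h0 h1 h2
    exact sign3 f hf hO t s h0 (by simp at h1; linarith) h2
  | succ n ih =>
    intro t s h0 h1 h2
    by_cases h : t/2 ≤ s
    · exact sign3 f hf hO t s h0 h h2
    push Not at h
    have a := sign3 f hf hO t (t/2) h0 le_rfl (by linarith)
    have b := ih (t/2) s (by linarith) (by rw [pow_succ] at h1; rwa [div_div, mul_comm]) h.le
    have c := mul_pos a b
    have d : 0 ≤ (f (0,0,t/2)).2.2 ^ 2 := sq_nonneg _
    by_contra hcon
    push Not at hcon
    nlinarith

lemma sign6 (f : H → H) (hf : IsBiLip ((1/1000000)^12) f) (hO : f HO = HO) (t s : ℝ)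
    (h0 : 0 < s) (h1 : s ≤ t) : 0 < (f (0,0,t)).2.2 * (f (0,0,s)).2.2 := by
  obtain ⟨n, hn⟩ := exists_nat_gt (t/s)
  refine sign5 f hf hO n t s (by linarith) ?_ h1
  have : (n:ℝ) < 2^n := by exact_mod_cast Nat.lt_two_pow_self
  rw [div_lt_iff₀ h0] at hn
  rw [div_le_iff₀ (by positivity)]
  nlinarith

lemma sign7 (f : H → H) (hf : IsBiLip ((1/1000000)^12) f) (hO : f HO = HO) :
    (∀ t, 0 ≤ t * (f (0,0,t)).2.2) ∨ (∀ t, t * (f (0,0,t)).2.2 ≤ 0) := by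
  have hp : ∀ t, 0 < t → 0 < (f (0,0,1)).2.2 * (f (0,0,t)).2.2 := by
    intro t ht
    rcases le_total t 1 with h | h
    · exact sign6 f hf hO 1 t ht h
    · rw [mul_comm]; exact sign6 f hf hO t 1 one_pos h
  have hn : ∀ t, t < 0 → (f (0,0,1)).2.2 * (f (0,0,t)).2.2 < 0 := by
    intro t ht
    have a := hp (-t) (by linarith)
    have b := sign4 f hf hO (-t) (by linarith)
    rw [neg_neg] at b
    by_contra hcon
    push Not at hcon
    nlinarith [mul_pos_of_neg_of_neg b (show -((f (0,0,1)).2.2 * (f (0,0,-t)).2.2) < 0 by linarith), sq_nonneg (f (0,0,-t)).2.2,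
      mul_nonneg (sq_nonneg (f (0,0,-t)).2.2) hcon]
  have h1 := hp 1 one_pos
  rcases lt_trichotomy (f (0,0,1)).2.2 0 with h | h | h
  · right
    intro t
    rcases lt_trichotomy t 0 with h' | h' | h'
    · have := hn t h'
      have : 0 < (f (0,0,t)).2.2 := pos_of_mul_neg_right this h.le
      nlinarith
    · simp [h']
    · have := hp t h'
      have : (f (0,0,t)).2.2 < 0 := by
        by_contra hcon
        push Not at hcon
        nlinarith
      nlinarith
  · rw [h] at h1; simp at h1
  · left
    intro t
    rcases lt_trichotomy t 0 with h' | h' | h'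
    · have := hn t h'
      have : (f (0,0,t)).2.2 < 0 := by
        by_contra hcon
        push Not at hcon
        nlinarith
      nlinarith
    · simp [h']
    · have := hp t h'
      have : 0 < (f (0,0,t)).2.2 := by
        by_contra hcon
        push Not at hcon
        nlinarith
      nlinarith

lemma fin1 (δ : ℝ) (h0 : 0 < δ) (h1 : δ ≤ 1/1000000) (p : H) (t : ℝ)
    (a1 : √(p.1^2+p.2.1^2) ≤ 3400 * δ * √|t|) (a2 : |(|p.2.2| - |t|)| ≤ 15000 * δ * |t|)
    (hs : 0 ≤ t * p.2.2) : dH p (0,0,t) ≤ 6000 * √δ * dH HO (0,0,t) := by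
  have e1 : |t - p.2.2| = |(|p.2.2| - |t|)| := by
    rcases lt_trichotomy t 0 with h | h | h
    · have : p.2.2 ≤ 0 := by
        by_contra hcon
        push Not at hcon
        nlinarith
      rw [abs_of_neg h, abs_of_nonpos this]; congr 1; ring
    · subst h; simp
    · have : 0 ≤ p.2.2 := by
        by_contra hcon
        push Not at hcon
        nlinarith
      rw [abs_of_pos h, abs_of_nonneg this, abs_sub_comm]
  obtain ⟨k1, k2⟩ := kap_bd
  have e2 : dH HO (0,0,t) = NH (0,0,1) * √|t| := NH_vert t
  rw [e2, dH_NH, dH_coord]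
  have e3 : t - p.2.2 + 2 * (p.1 * (0 - p.2.1) - p.2.1 * (0 - p.1)) = t - p.2.2 := by ring
  have hu := NH_up (0 - p.1) (0 - p.2.1) (t - p.2.2)
  simp only [e3]
  refine hu.trans ?_
  rw [e1]
  set d := √δ with hd
  have hd0 : 0 ≤ d := Real.sqrt_nonneg _
  have hd2 : d^2 = δ := Real.sq_sqrt h0.le
  have hd1 : d ≤ 1/1000 := by
    rw [hd, Real.sqrt_le_left (by norm_num)]; linarith
  set w := √|t| with hw
  have hw0 : 0 ≤ w := Real.sqrt_nonneg _
  have hw2 : w^2 = |t| := Real.sq_sqrt (abs_nonneg _)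
  have h3 : √|(|p.2.2| - |t|)| ≤ 125 * d * w := by
    rw [Real.sqrt_le_left (by positivity)]
    refine a2.trans ?_
    rw [← hw2, ← hd2]
    nlinarith [sq_nonneg (d*w)]
  have h4 : √((0 - p.1)^2 + (0 - p.2.1)^2) = √(p.1^2+p.2.1^2) := by congr 1; ring
  rw [h4]
  have hdw : 0 ≤ d * w := by positivity
  have h5 : 3400 * δ * w ≤ 3400 * (1/1000) * (d * w) := by
    rw [← hd2]; nlinarith
  have h6 : 6000 * d * (7/10 * w) ≤ 6000 * d * (NH (0,0,1) * w) := by gcongr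
  linarith

lemma fin2 (δ : ℝ) (h0 : 0 < δ) (h1 : δ ≤ 1/1000000) (f : H → H) (hf : IsBiLip (δ^12) f)
    (hO : f HO = HO) (hs : ∀ t, 0 ≤ t * (f (0,0,t)).2.2) (t : ℝ) :
    dH (f (0,0,t)) (0,0,t) ≤ 6000 * √δ * dH HO (0,0,t) := by
  obtain ⟨a1, a2⟩ := key δ h0 h1 f hf hO t
  exact fin1 δ h0 h1 _ t a1 a2 (hs t)

lemma fin3 (δ : ℝ) (h0 : 0 < δ) (h1 : δ ≤ 1/1000000) (f : H → H) (hf : IsBiLip (δ^12) f)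
    (hO : f HO = HO) (hs : ∀ t, t * (f (0,0,t)).2.2 ≤ 0) (t : ℝ) :
    dH ((f (0,0,t)).1, -(f (0,0,t)).2.1, -(f (0,0,t)).2.2) (0,0,t)
      ≤ 6000 * √δ * dH HO (0,0,t) := by
  obtain ⟨a1, a2⟩ := key δ h0 h1 f hf hO t
  exact fin1 δ h0 h1 _ t (by simpa using a1) (by simpa using a2) (by have := hs t; simp; linarith)

lemma fin4 {ε : ℝ} (h0 : 0 ≤ ε) (h1 : ε < (1/1000000)^12) (A D : ℝ) (hD : 0 ≤ D)
    (h : ∀ δ : ℝ, 0 < δ → δ ≤ 1/1000000 → ε ≤ δ^12 → A ≤ 6000 * √δ * D) :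
    A ≤ 6000 * ε ^ ((1:ℝ)/32) * D := by
  rcases h0.eq_or_lt with e | hp
  · subst e
    rw [Real.zero_rpow (by norm_num), mul_zero, zero_mul]
    have lim : Filter.Tendsto (fun δ : ℝ => 6000 * √δ * D) (nhdsWithin 0 (Set.Ioi 0)) (nhds 0) := by
      have : Continuous (fun δ : ℝ => 6000 * √δ * D) := by fun_prop
      have := this.tendsto 0
      simp only [Real.sqrt_zero, mul_zero, zero_mul] at this
      exact this.mono_left nhdsWithin_le_nhds
    refine ge_of_tendsto lim ?_
    filter_upwards [Ioo_mem_nhdsGT (show (0:ℝ) < 1/1000000 by norm_num)] with δ hδ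
    exact h δ hδ.1 hδ.2.le (by have := hδ.1; positivity)
  · have hδ : 0 < ε ^ ((1:ℝ)/12) := Real.rpow_pos_of_pos hp _
    have e12 : (ε ^ ((1:ℝ)/12))^12 = ε := by
      rw [← Real.rpow_natCast, ← Real.rpow_mul h0]; norm_num
    have h2 := h _ hδ (by
      by_contra hcon
      push Not at hcon
      have := pow_lt_pow_left₀ hcon (by norm_num) (show 12 ≠ 0 by norm_num)
      rw [e12] at this
      linarith) e12.ge
    refine h2.trans ?_
    gcongr
    rw [Real.sqrt_eq_rpow, ← Real.rpow_mul h0]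
    apply Real.rpow_le_rpow_of_exponent_ge hp _ (by norm_num)
    refine h1.le.trans (by norm_num)

/-- Theorem C, biLipschitz image of the `t`-axis.
There are `ε₀ > 0` and `C > 0` such that if `f` is a `(1+ε)`-biLipschitz self
map of `ℍ` with `ε < ε₀` and `f(O) = O`, then, with `g(x,y,t) = (x,−y,−t)`,
either `d(f(0;t),(0;t)) ≤ C ε^{1/32} d(O,(0;t))` for all `t`, or
`d(g(f(0;t)),(0;t)) ≤ C ε^{1/32} d(O,(0;t))` for all `t`. -/
theorem statement4 :
    ∃ ε₀ > (0:ℝ), ∃ C > (0:ℝ),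
      ∀ ε : ℝ, 0 ≤ ε → ε < ε₀ →
      ∀ f : H → H, IsBiLip ε f → f HO = HO →
        (∀ t : ℝ, dH (f (0, 0, t)) (0, 0, t)
            ≤ C * ε ^ ((1:ℝ)/32) * dH HO (0, 0, t)) ∨
        (∀ t : ℝ, dH ((f (0, 0, t)).1, -(f (0, 0, t)).2.1, -(f (0, 0, t)).2.2) (0, 0, t)
            ≤ C * ε ^ ((1:ℝ)/32) * dH HO (0, 0, t)) := by
  refine ⟨(1/1000000)^12, by norm_num, 6000, by norm_num, ?_⟩
  intro ε h0 h1 f hf hO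
  rcases sign7 f (bilip_mono h0 h1.le hf) hO with hs | hs
  · left
    intro t
    exact fin4 h0 h1 _ _ (dH_nonneg _ _)
      (fun δ hδ hδ1 h => fin2 δ hδ hδ1 f (bilip_mono h0 h hf) hO hs t)
  · right
    intro t
    exact fin4 h0 h1 _ _ (dH_nonneg _ _)
      (fun δ hδ hδ1 h => fin3 δ hδ hδ1 f (bilip_mono h0 h hf) hO hs t)
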